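/- arXiv:1909.09345 — 2 statements merged into one kernel-verified Lean document; each statement's English description precedes it below -/
import Mathlib

section
/- Let p ≥ 1 and let λ = (λ₁,…,λ_p) be nonincreasing nonnegative weights. Consider the unit dual SLOPE ball D₁ = { v ∈ ℝ^p : Σ_{i=1}^j |v|_{(i)} ≤ Σ_{i=1}^j λ_i for all 1 ≤ j ≤ p }. Then max{ ‖z‖₂ : z ∈ D₁ } = ‖λ‖₂, with the maximum attained at z = λ. Consequently, for any x ∈ ℝ^p and χ ≥ 0, if h is a standard Gaussian vector in ℝ^p then E‖η(x + h; χ, λ) − x‖₂² ≤ p + χ²‖λ‖₂². -/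
open MeasureTheory ProbabilityTheory Filter

/-- Standard Gaussian measure `N(0, I_n)` on `ℝⁿ`. -/
noncomputable def stdGaussian (n : ℕ) : Measure (Fin n → ℝ) :=
  Measure.pi fun _ => gaussianReal 0 1

/-- The nonincreasing rearrangement of the absolute values of the entries of `x`. -/
noncomputable def sortedAbs {n : ℕ} (x : Fin n → ℝ) : Fin n → ℝ :=
  fun i => |x ((Tuple.sort fun j => -|x j|) i)|

/-- The sorted-ℓ1 (SLOPE) norm `‖x‖_λ = ∑ λ_i |x|_(i)`. -/
noncomputable def slopeNorm {n : ℕ} (lam x : Fin n → ℝ) : ℝ :=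
  ∑ i, lam i * sortedAbs x i

/-- The SLOPE proximal objective `½‖u − v‖₂² + γ‖v‖_λ`. -/
noncomputable def slopeObj {n : ℕ} (lam : Fin n → ℝ) (γ : ℝ) (u v : Fin n → ℝ) : ℝ :=
  (1/2) * ∑ i, (u i - v i)^2 + γ * slopeNorm lam v

/-- `v` is a minimizer of the SLOPE proximal objective, i.e. `v = η(u; γ, λ)`
(the minimizer is unique since the objective is strictly convex). -/
def IsSlopeProx {n : ℕ} (lam : Fin n → ℝ) (γ : ℝ) (u v : Fin n → ℝ) : Prop :=
  ∀ w, slopeObj lam γ u v ≤ slopeObj lam γ u w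

/-- The dual SLOPE norm ball of radius `γ`:
`D_γ = { v : Σ_{i≤j} |v|_(i) ≤ γ Σ_{i≤j} λ_i for all 1 ≤ j ≤ n }`. -/
noncomputable def slopeDualBall {n : ℕ} (lam : Fin n → ℝ) (γ : ℝ) : Set (Fin n → ℝ) :=
  {v | ∀ j : ℕ, 1 ≤ j → j ≤ n →
    (∑ i : Fin n, if (i : ℕ) < j then sortedAbs v i else 0)
      ≤ γ * ∑ i : Fin n, if (i : ℕ) < j then lam i else 0}

/-- Summation by parts for an antitone sequence against nonnegative partial sums. -/
theorem mul_sum_range_le_sum_range_mul {a d : ℕ → ℝ} (ha : Antitone a)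
    (hd : ∀ n, 0 ≤ ∑ i ∈ Finset.range n, d i) (n : ℕ) :
    a n * ∑ i ∈ Finset.range n, d i ≤ ∑ i ∈ Finset.range n, a i * d i := by
  induction n with
  | zero => simp
  | succ n ih =>
    have h1 := mul_le_mul_of_nonneg_right (ha n.le_succ) (hd (n + 1))
    rw [Finset.sum_range_succ] at h1 ⊢
    rw [Finset.sum_range_succ]
    simp only [Nat.succ_eq_add_one] at h1
    linarith

theorem sum_mul_nonneg_of_antitone {n : ℕ} {a d : Fin n → ℝ} (ha : Antitone a)
    (ha0 : ∀ i, 0 ≤ a i)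
    (hd : ∀ j : ℕ, 1 ≤ j → j ≤ n → 0 ≤ ∑ i : Fin n, if (i : ℕ) < j then d i else 0) :
    0 ≤ ∑ i, a i * d i := by
  set A : ℕ → ℝ := fun k => if h : k < n then a ⟨k, h⟩ else 0 with hA
  set D : ℕ → ℝ := fun k => if h : k < n then d ⟨k, h⟩ else 0 with hD
  have hAant : Antitone A := by
    intro k l hkl
    by_cases hl : l < n
    · have hk : k < n := hkl.trans_lt hl
      simpa [hA, hl, hk] using ha (show (⟨k, hk⟩ : Fin n) ≤ ⟨l, hl⟩ from hkl)
    · by_cases hk : k < n <;> simp [hA, hl, hk, ha0]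
  have hpart : ∀ m, m ≤ n → 0 ≤ ∑ i ∈ Finset.range m, D i := by
    intro m hm
    rcases Nat.eq_zero_or_pos m with rfl | hm0
    · simp
    · have h := hd m hm0 hm
      have e : ∑ i : Fin n, (if (i : ℕ) < m then d i else 0)
          = ∑ i : Fin n, (fun k : ℕ => if k < m then D k else 0) i := by
        refine Finset.sum_congr rfl fun i _ => ?_
        simp [hD]
      rw [e, Fin.sum_univ_eq_sum_range (fun k : ℕ => if k < m then D k else 0),
        ← Finset.sum_filter] at h
      convert h using 2
      ext k
      simp only [Finset.mem_range, Finset.mem_filter]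
      omega
  have hall : ∀ m, 0 ≤ ∑ i ∈ Finset.range m, D i := by
    intro m
    rcases le_total m n with hm | hm
    · exact hpart m hm
    · refine (hpart n le_rfl).trans_eq (Finset.sum_subset (Finset.range_mono hm) ?_)
      intro k _ hk
      simp only [Finset.mem_range] at hk
      simp [hD, hk]
  have key := mul_sum_range_le_sum_range_mul hAant hall n
  rw [← Fin.sum_univ_eq_sum_range (fun k => A k * D k)] at key
  simpa [hA, hD] using key

theorem sortedAbs_nonneg {n : ℕ} (x : Fin n → ℝ) (i : Fin n) : 0 ≤ sortedAbs x i :=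
  abs_nonneg _

theorem antitone_sortedAbs {n : ℕ} (x : Fin n → ℝ) : Antitone (sortedAbs x) := by
  intro i j hij
  have h := Tuple.monotone_sort (fun j => -|x j|) hij
  simpa [sortedAbs] using h

theorem sum_sortedAbs_sq {n : ℕ} (x : Fin n → ℝ) :
    ∑ i, sortedAbs x i ^ 2 = ∑ i, x i ^ 2 := by
  simp only [sortedAbs, sq_abs]
  exact Equiv.sum_comp (Tuple.sort fun j => -|x j|) fun i => x i ^ 2

/-- The rearrangement inequality for the SLOPE norm. -/
theorem sum_mul_abs_comp_perm_le_slopeNorm {n : ℕ} {lam : Fin n → ℝ} (hlam : Antitone lam)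
    (x : Fin n → ℝ) (σ : Equiv.Perm (Fin n)) :
    ∑ i, lam i * |x (σ i)| ≤ slopeNorm lam x := by
  have h := (hlam.monovary (antitone_sortedAbs x)).sum_mul_comp_perm_le_sum_mul
    (σ := σ.trans (Tuple.sort fun j => -|x j|).symm)
  simpa [sortedAbs, slopeNorm] using h

theorem slopeNorm_add_le {n : ℕ} {lam : Fin n → ℝ} (hlam : Antitone lam)
    (hlam0 : ∀ i, 0 ≤ lam i) (x y : Fin n → ℝ) :
    slopeNorm lam (x + y) ≤ slopeNorm lam x + slopeNorm lam y := by
  let σ := Tuple.sort fun j => -|(x + y) j|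
  calc slopeNorm lam (x + y) = ∑ i, lam i * |x (σ i) + y (σ i)| := rfl
    _ ≤ ∑ i, (lam i * |x (σ i)| + lam i * |y (σ i)|) := by
        refine Finset.sum_le_sum fun i _ => ?_
        rw [← mul_add]
        exact mul_le_mul_of_nonneg_left (abs_add_le _ _) (hlam0 i)
    _ ≤ _ := by
        rw [Finset.sum_add_distrib]
        exact add_le_add (sum_mul_abs_comp_perm_le_slopeNorm hlam x σ)
          (sum_mul_abs_comp_perm_le_slopeNorm hlam y σ)

theorem slopeNorm_smul_le {n : ℕ} {lam : Fin n → ℝ} (hlam : Antitone lam) {t : ℝ}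
    (ht : 0 ≤ t) (x : Fin n → ℝ) : slopeNorm lam (t • x) ≤ t * slopeNorm lam x := by
  let σ := Tuple.sort fun j => -|(t • x) j|
  calc slopeNorm lam (t • x) = t * ∑ i, lam i * |x (σ i)| := by
        rw [Finset.mul_sum]
        refine Finset.sum_congr rfl fun i _ => ?_
        simp only [sortedAbs, Pi.smul_apply, smul_eq_mul, abs_mul, abs_of_nonneg ht, σ]
        ring
    _ ≤ _ := mul_le_mul_of_nonneg_left (sum_mul_abs_comp_perm_le_slopeNorm hlam x σ) ht

theorem sqrt_sum_sq_le_of_mem_slopeDualBall {n : ℕ} {lam z : Fin n → ℝ}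
    (hz : z ∈ slopeDualBall lam 1) :
    Real.sqrt (∑ i, z i ^ 2) ≤ Real.sqrt (∑ i, lam i ^ 2) := by
  apply Real.sqrt_le_sqrt
  have h := sum_mul_nonneg_of_antitone (d := fun i => lam i - sortedAbs z i)
    (antitone_sortedAbs z) (sortedAbs_nonneg z) (by
      intro j h1 h2
      have h := hz j h1 h2
      rw [one_mul, ← sub_nonneg, ← Finset.sum_sub_distrib] at h
      refine h.trans_eq (Finset.sum_congr rfl fun i _ => ?_)
      split_ifs <;> simp)
  rw [← sum_sortedAbs_sq z, ← sub_nonneg, ← Finset.sum_sub_distrib]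
  have h2 : ∀ i, 2 * (sortedAbs z i * (lam i - sortedAbs z i))
      ≤ lam i ^ 2 - sortedAbs z i ^ 2 := fun i => by
    nlinarith [sq_nonneg (lam i - sortedAbs z i)]
  have h3 := Finset.sum_le_sum fun i (_ : i ∈ Finset.univ) => h2 i
  rw [← Finset.mul_sum] at h3
  linarith

theorem self_mem_slopeDualBall {n : ℕ} {lam : Fin n → ℝ} (hlam : Antitone lam)
    (hlam0 : ∀ i, 0 ≤ lam i) : lam ∈ slopeDualBall lam 1 := by
  intro j _ _
  have hind : Antitone fun i : Fin n => if (i : ℕ) < j then (1 : ℝ) else 0 := by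
    intro i k hik
    have hik' : (i : ℕ) ≤ k := hik
    dsimp only
    split_ifs <;> first | omega | norm_num
  have h := (hind.monovary hlam).sum_mul_comp_perm_le_sum_mul
    (σ := Tuple.sort fun j => -|lam j|)
  simpa [sortedAbs, abs_of_nonneg (hlam0 _)] using h

/-- First-order optimality of the proximal point along a segment. -/
theorem IsSlopeProx.le_of_forall_segment {n : ℕ} {lam : Fin n → ℝ} {γ c : ℝ}
    {u v : Fin n → ℝ} (hγ : 0 ≤ γ) (hv : IsSlopeProx lam γ u v) (d : Fin n → ℝ)
    (hd : ∀ t : ℝ, 0 < t → t ≤ 1 → slopeNorm lam (v + t • d) ≤ slopeNorm lam v + t * c) :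
    ∑ i, (u i - v i) * d i ≤ γ * c := by
  have key : ∀ t : ℝ, 0 < t → t ≤ 1 →
      ∑ i, (u i - v i) * d i ≤ γ * c + t * ((1 / 2) * ∑ i, d i ^ 2) := by
    intro t ht ht1
    have h1 := hv (v + t • d)
    have h2 := mul_le_mul_of_nonneg_left (hd t ht ht1) hγ
    have e : ∑ i, (u i - (v + t • d) i) ^ 2 = ∑ i, (u i - v i) ^ 2
        - 2 * t * ∑ i, (u i - v i) * d i + t ^ 2 * ∑ i, d i ^ 2 := by
      rw [Finset.mul_sum, Finset.mul_sum, ← Finset.sum_sub_distrib, ← Finset.sum_add_distrib]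
      refine Finset.sum_congr rfl fun i _ => ?_
      simp only [Pi.add_apply, Pi.smul_apply, smul_eq_mul]
      ring
    simp only [slopeObj, e] at h1
    refine le_of_mul_le_mul_left ?_ ht
    nlinarith
  have hlim : Tendsto (fun t : ℝ => γ * c + t * ((1 / 2) * ∑ i, d i ^ 2))
      (nhdsWithin 0 (Set.Ioi 0)) (nhds (γ * c)) := by
    have : Continuous fun t : ℝ => γ * c + t * ((1 / 2) * ∑ i, d i ^ 2) := by fun_prop
    simpa using (this.tendsto 0).mono_left nhdsWithin_le_nhds
  refine ge_of_tendsto hlim ?_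
  filter_upwards [Ioc_mem_nhdsGT (zero_lt_one (α := ℝ))] with t ht using key t ht.1 ht.2

theorem IsSlopeProx.residual_le {n : ℕ} {lam : Fin n → ℝ} (hlam : Antitone lam)
    (hlam0 : ∀ i, 0 ≤ lam i) {γ : ℝ} {u v : Fin n → ℝ} (hγ : 0 ≤ γ)
    (hv : IsSlopeProx lam γ u v) (w : Fin n → ℝ) :
    ∑ i, (u i - v i) * w i ≤ γ * slopeNorm lam w :=
  hv.le_of_forall_segment hγ w fun _ ht _ =>
    (slopeNorm_add_le hlam hlam0 _ _).trans
      (add_le_add le_rfl (slopeNorm_smul_le hlam ht.le _))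

theorem IsSlopeProx.le_residual {n : ℕ} {lam : Fin n → ℝ} (hlam : Antitone lam)
    {γ : ℝ} {u v : Fin n → ℝ} (hγ : 0 ≤ γ) (hv : IsSlopeProx lam γ u v) :
    γ * slopeNorm lam v ≤ ∑ i, (u i - v i) * v i := by
  have h := hv.le_of_forall_segment (c := -slopeNorm lam v) hγ (-v) fun t _ ht1 => by
    have e : v + t • -v = (1 - t) • v := by
      rw [sub_smul, one_smul, smul_neg, sub_eq_add_neg]
    rw [e]
    exact (slopeNorm_smul_le hlam (sub_nonneg.2 ht1) v).trans_eq (by ring)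
  simp only [Pi.neg_apply, mul_neg, Finset.sum_neg_distrib] at h
  linarith

theorem IsSlopeProx.residual_monotone {n : ℕ} {lam : Fin n → ℝ} (hlam : Antitone lam)
    (hlam0 : ∀ i, 0 ≤ lam i) {γ : ℝ} {u v u' v' : Fin n → ℝ} (hγ : 0 ≤ γ)
    (hv : IsSlopeProx lam γ u v) (hv' : IsSlopeProx lam γ u' v') :
    0 ≤ ∑ i, ((u i - v i) - (u' i - v' i)) * (u i - u' i) := by
  have h1 := hv.residual_le hlam hlam0 hγ v'
  have h2 := hv'.residual_le hlam hlam0 hγ v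
  have h3 := hv.le_residual hlam hγ
  have h4 := hv'.le_residual hlam hγ
  have h5 : 0 ≤ ∑ i, ((u i - v i) - (u' i - v' i)) ^ 2 :=
    Finset.sum_nonneg fun i _ => sq_nonneg _
  have e : ∑ i, ((u i - v i) - (u' i - v' i)) * (u i - u' i)
      = ∑ i, ((u i - v i) - (u' i - v' i)) ^ 2 + (∑ i, (u i - v i) * v i
        - ∑ i, (u i - v i) * v' i) + (∑ i, (u' i - v' i) * v' i
        - ∑ i, (u' i - v' i) * v i) := by
    rw [← Finset.sum_sub_distrib, ← Finset.sum_sub_distrib, ← Finset.sum_add_distrib,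
      ← Finset.sum_add_distrib]
    exact Finset.sum_congr rfl fun i _ => by ring
  linarith

theorem IsSlopeProx.sum_residual_sq_le {n : ℕ} {lam : Fin n → ℝ} (hlam : Antitone lam)
    (hlam0 : ∀ i, 0 ≤ lam i) {γ : ℝ} {u v : Fin n → ℝ} (hγ : 0 ≤ γ)
    (hv : IsSlopeProx lam γ u v) :
    ∑ i, (u i - v i) ^ 2 ≤ γ ^ 2 * ∑ i, lam i ^ 2 := by
  have h1 := hv.residual_le hlam hlam0 hγ (fun i => u i - v i)
  rw [slopeNorm] at h1
  have h2 : ∀ i, 2 * (γ * (lam i * sortedAbs (fun i => u i - v i) i))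
      ≤ γ ^ 2 * lam i ^ 2 + sortedAbs (fun i => u i - v i) i ^ 2 := fun i => by
    nlinarith [sq_nonneg (γ * lam i - sortedAbs (fun i => u i - v i) i)]
  have h3 := Finset.sum_le_sum fun i (_ : i ∈ Finset.univ) => h2 i
  rw [← Finset.mul_sum, Finset.sum_add_distrib, sum_sortedAbs_sq, ← Finset.mul_sum,
    ← Finset.mul_sum] at h3
  simp only [← sq] at h1
  linarith

theorem IsSlopeProx.sum_sub_sq_le {n : ℕ} {lam : Fin n → ℝ} (hlam : Antitone lam)
    (hlam0 : ∀ i, 0 ≤ lam i) {γ : ℝ} {x h v w : Fin n → ℝ} (hγ : 0 ≤ γ)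
    (hv : IsSlopeProx lam γ (fun j => x j + h j) v) (hw : IsSlopeProx lam γ x w) :
    ∑ i, (v i - x i) ^ 2
      ≤ ∑ i, (h i ^ 2 - 2 * (x i - w i) * h i) + γ ^ 2 * ∑ i, lam i ^ 2 := by
  have h1 := hv.residual_monotone hlam hlam0 hγ hw
  have h2 := hv.sum_residual_sq_le hlam hlam0 hγ
  have e : ∑ i, (v i - x i) ^ 2 = ∑ i, (h i ^ 2 - 2 * (x i - w i) * h i)
      + ∑ i, (x i + h i - v i) ^ 2
      - 2 * ∑ i, ((x i + h i - v i) - (x i - w i)) * (x i + h i - x i) := by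
    rw [Finset.mul_sum, ← Finset.sum_add_distrib, ← Finset.sum_sub_distrib]
    exact Finset.sum_congr rfl fun i _ => by ring
  linarith

theorem memLp_eval_stdGaussian (n : ℕ) (i : Fin n) :
    MemLp (fun h : Fin n → ℝ => h i) 2 (_root_.stdGaussian n) :=
  (memLp_id_gaussianReal (μ := 0) (v := 1) 2).comp_measurePreserving
    (measurePreserving_eval (fun _ : Fin n => gaussianReal 0 1) i)

theorem integral_eval_stdGaussian (n : ℕ) (i : Fin n) :
    ∫ h, h i ∂ _root_.stdGaussian n = 0 := by
  have := integral_comp_eval (μ := fun _ : Fin n => gaussianReal 0 1) (i := i) (f := fun t : ℝ => t)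
    (by fun_prop)
  simpa [_root_.stdGaussian] using this

theorem integral_eval_sq_stdGaussian (n : ℕ) (i : Fin n) :
    ∫ h, h i ^ 2 ∂ _root_.stdGaussian n = 1 := by
  have h1 := integral_comp_eval (μ := fun _ : Fin n => gaussianReal 0 1) (i := i)
    (f := fun t : ℝ => t ^ 2) (by fun_prop)
  have h2 : ∫ t : ℝ, t ^ 2 ∂ gaussianReal 0 1 = 1 := by
    have := variance_of_integral_eq_zero (μ := gaussianReal 0 1) (X := fun t : ℝ => t)
      aemeasurable_id (by simp)
    rw [← this]
    simp
  exact h1.trans h2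

/-- the maximal ℓ2-norm over the unit dual SLOPE ball `D₁` is `‖λ‖₂`,
attained at `λ`; consequently `E‖η(x + h; χ) − x‖₂² ≤ p + χ²‖λ‖₂²`. -/
theorem slope_dual_ball_diameter
    (p : ℕ) (hp : 1 ≤ p)
    (lam : Fin p → ℝ)
    (hmono : ∀ i j : Fin p, i ≤ j → lam j ≤ lam i)
    (hnonneg : ∀ i, 0 ≤ lam i)
    (η : ℝ → (Fin p → ℝ) → (Fin p → ℝ))
    (hη : ∀ γ u, 0 ≤ γ → IsSlopeProx lam γ u (η γ u)) :
    lam ∈ slopeDualBall lam 1 ∧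
    (∀ z ∈ slopeDualBall lam 1,
      Real.sqrt (∑ i, (z i) ^ 2) ≤ Real.sqrt (∑ i, lam i ^ 2)) ∧
    ∀ (x : Fin p → ℝ) (χ : ℝ), 0 ≤ χ →
      (∫ h, (∑ i, (η χ (fun j => x j + h j) i - x i) ^ 2) ∂ stdGaussian p)
        ≤ (p : ℝ) + χ ^ 2 * ∑ i, lam i ^ 2 := by
  have hlam : Antitone lam := fun i j hij => hmono i j hij
  refine ⟨self_mem_slopeDualBall hlam hnonneg,
    fun z hz => sqrt_sum_sq_le_of_mem_slopeDualBall hz, fun x χ hχ => ?_⟩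
  have : IsProbabilityMeasure (_root_.stdGaussian p) := by
    unfold _root_.stdGaussian
    infer_instance
  have hsq (i : Fin p) : Integrable (fun h : Fin p → ℝ => h i ^ 2) (_root_.stdGaussian p) :=
    (memLp_eval_stdGaussian p i).integrable_sq
  have hlin (i : Fin p) : Integrable (fun h : Fin p → ℝ => 2 * (x i - η χ x i) * h i)
      (_root_.stdGaussian p) :=
    ((memLp_eval_stdGaussian p i).integrable one_le_two).const_mul _
  have hdiff (i : Fin p) : Integrable (fun h : Fin p → ℝ =>
      h i ^ 2 - 2 * (x i - η χ x i) * h i) (_root_.stdGaussian p) :=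
    (hsq i).sub (hlin i)
  have hsum : Integrable (fun h : Fin p → ℝ =>
      ∑ i, (h i ^ 2 - 2 * (x i - η χ x i) * h i)) (_root_.stdGaussian p) :=
    integrable_finsetSum _ fun i _ => hdiff i
  calc ∫ h, (∑ i, (η χ (fun j => x j + h j) i - x i) ^ 2) ∂ _root_.stdGaussian p
      ≤ ∫ h, (∑ i, (h i ^ 2 - 2 * (x i - η χ x i) * h i) + χ ^ 2 * ∑ i, lam i ^ 2)
          ∂ _root_.stdGaussian p :=
        integral_mono_of_nonneg
          (Eventually.of_forall fun h => Finset.sum_nonneg fun i _ => sq_nonneg _)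
          (hsum.add (integrable_const _))
          (Eventually.of_forall fun h =>
            (hη χ _ hχ).sum_sub_sq_le hlam hnonneg hχ (hη χ x hχ))
    _ = (p : ℝ) + χ ^ 2 * ∑ i, lam i ^ 2 := by
        rw [integral_add hsum (integrable_const _),
          integral_finsetSum _ fun i _ => hdiff i]
        simp_rw [integral_sub (hsq _) (hlin _), integral_const_mul,
          integral_eval_stdGaussian, integral_eval_sq_stdGaussian]
        simp
end

section
/- Let Z be a standard one-dimensional Gaussian random variable, let φ(x) = (2π)^{-1/2} e^{-x²/2} denote its density and Φ its cumulative distribution function, and write (t)₊ = max(t, 0). Then for every x ≥ 0: (i) (1/2)·E(|Z| − x)₊² = (1 + x²)Φ(−x) − xφ(x), and this quantity is at least max( φ(x)/(2(1 + x³)), φ(√2·x)/2 ); (ii) φ(x)/(1 + x) ≤ Φ(−x) ≤ 2φ(x)/(1 + x); (iii) φ(x) − xΦ(−x) ≥ (1/2)φ(√2·x), and for every x > 0, φ(x)/x ≥ φ(√2·x). -/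
open MeasureTheory ProbabilityTheory

/-- The standard normal density `φ(x) = (2π)^{-1/2} e^{-x²/2}`. -/
noncomputable def stdPDF (x : ℝ) : ℝ :=
  (Real.sqrt (2 * Real.pi))⁻¹ * Real.exp (-(x ^ 2) / 2)

/-- The standard normal cumulative distribution function `Φ`. -/
noncomputable def stdCDF (x : ℝ) : ℝ :=
  ((gaussianReal 0 1) (Set.Iic x)).toReal

open Filter Topology Set

theorem stdPDF_pos (x : ℝ) : 0 < stdPDF x := by
  unfold stdPDF
  positivity

theorem gaussianPDFReal_zero_one (x : ℝ) : gaussianPDFReal 0 1 x = stdPDF x := by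
  simp [gaussianPDFReal, stdPDF]

theorem hasDerivAt_neg_sq_div_two (x : ℝ) :
    HasDerivAt (fun y : ℝ => -(y ^ 2) / 2) (-x) x := by
  refine ((hasDerivAt_pow 2 x).neg.div_const 2).congr_deriv ?_
  norm_num
  ring

theorem hasDerivAt_stdPDF (x : ℝ) : HasDerivAt stdPDF (-x * stdPDF x) x := by
  refine ((hasDerivAt_neg_sq_div_two x).exp.const_mul (Real.sqrt (2 * Real.pi))⁻¹).congr_deriv ?_
  unfold stdPDF
  ring

theorem continuous_stdPDF : Continuous stdPDF :=
  continuous_iff_continuousAt.2 fun x => (hasDerivAt_stdPDF x).continuousAt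

theorem integrable_stdPDF : Integrable stdPDF := by
  have h := integrable_gaussianPDFReal 0 1
  rwa [show gaussianPDFReal 0 1 = stdPDF from funext gaussianPDFReal_zero_one] at h

theorem stdCDF_eq_integral (x : ℝ) : stdCDF x = ∫ t in Iic x, stdPDF t := by
  unfold stdCDF
  rw [gaussianReal_apply_eq_integral 0 one_ne_zero]
  simp_rw [gaussianPDFReal_zero_one]
  exact ENNReal.toReal_ofReal (integral_nonneg fun t => (stdPDF_pos t).le)

theorem hasDerivAt_stdCDF (x : ℝ) : HasDerivAt stdCDF (stdPDF x) x := by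
  have h : stdCDF = fun y => (∫ t in (0 : ℝ)..y, stdPDF t) + stdCDF 0 := by
    funext y
    rw [stdCDF_eq_integral, stdCDF_eq_integral,
      ← intervalIntegral.integral_Iic_sub_Iic integrable_stdPDF.integrableOn
        integrable_stdPDF.integrableOn]
    ring
  rw [h]
  exact (intervalIntegral.integral_hasDerivAt_right
    (continuous_stdPDF.intervalIntegrable 0 x)
    (continuous_stdPDF.stronglyMeasurableAtFilter _ _)
    continuous_stdPDF.continuousAt).add_const _

theorem stdPDF_neg (x : ℝ) : stdPDF (-x) = stdPDF x := by
  simp [stdPDF]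

theorem stdPDF_abs (x : ℝ) : stdPDF |x| = stdPDF x := by
  simp [stdPDF]

theorem hasDerivAt_stdCDF_neg (x : ℝ) :
    HasDerivAt (fun y => stdCDF (-y)) (-stdPDF x) x := by
  have h := (hasDerivAt_stdCDF (-x)).comp x (hasDerivAt_neg x)
  refine h.congr_deriv ?_
  rw [stdPDF_neg]
  ring

theorem tendsto_stdCDF_neg : Tendsto (fun x => stdCDF (-x)) atTop (𝓝 0) := by
  have h := tendsto_measure_iInter_atBot (μ := gaussianReal 0 1) (s := fun x : ℝ => Iic x)
    (fun i => measurableSet_Iic.nullMeasurableSet) (fun i j hij => Iic_subset_Iic.2 hij)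
    ⟨0, measure_ne_top _ _⟩
  have he : ⋂ x : ℝ, Iic x = ∅ := by
    ext y
    simpa using ⟨y - 1, by linarith⟩
  rw [he, measure_empty] at h
  have h' := (ENNReal.tendsto_toReal ENNReal.zero_ne_top).comp h
  exact h'.comp tendsto_neg_atTop_atBot

theorem tendsto_pow_mul_stdPDF (n : ℕ) :
    Tendsto (fun x => x ^ n * stdPDF x) atTop (𝓝 0) := by
  have h := (Real.tendsto_pow_mul_exp_neg_atTop_nhds_zero n).const_mul
    ((Real.sqrt (2 * Real.pi))⁻¹)
  rw [mul_zero] at h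
  refine squeeze_zero' ?_ ?_ h
  · filter_upwards [eventually_ge_atTop 0] with x hx
    have := stdPDF_pos x
    positivity
  · filter_upwards [eventually_ge_atTop 2] with x hx
    unfold stdPDF
    rw [mul_left_comm]
    have : Real.exp (-(x ^ 2) / 2) ≤ Real.exp (-x) := Real.exp_le_exp.2 (by nlinarith)
    gcongr

theorem tendsto_stdPDF : Tendsto stdPDF atTop (𝓝 0) := by
  simpa using tendsto_pow_mul_stdPDF 0

theorem stdPDF_sqrt_two_mul (x : ℝ) :
    stdPDF (Real.sqrt 2 * x) = stdPDF x * Real.exp (-(x ^ 2) / 2) := by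
  unfold stdPDF
  rw [mul_assoc, ← Real.exp_add, mul_pow, Real.sq_sqrt (by norm_num)]
  ring_nf

theorem le_of_hasDerivAt_nonneg_of_tendsto {f f' : ℝ → ℝ} {a l : ℝ}
    (hd : ∀ x ∈ Ici a, HasDerivAt f (f' x) x) (hf : ∀ x ∈ Ici a, 0 ≤ f' x)
    (hl : Tendsto f atTop (𝓝 l)) : f a ≤ l := by
  have h := integral_Ioi_of_hasDerivAt_of_nonneg' hd (fun x hx => hf x (Ioi_subset_Ici_self hx)) hl
  have : 0 ≤ ∫ x in Ioi a, f' x :=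
    setIntegral_nonneg measurableSet_Ioi fun x hx => hf x (Ioi_subset_Ici_self hx)
  linarith

theorem tendsto_stdPDF_mul {R : ℝ → ℝ} {a C : ℝ} (hb : ∀ x ∈ Ici a, |R x| ≤ C) :
    Tendsto (fun x => stdPDF x * R x) atTop (𝓝 0) := by
  refine tendsto_stdPDF.zero_mul_isBoundedUnder_le ⟨C, ?_⟩
  rw [eventually_map]
  filter_upwards [eventually_ge_atTop a] with x hx using hb x hx

theorem stdPDF_mul_le_stdCDF_neg {R R' : ℝ → ℝ} {a C : ℝ}
    (hd : ∀ x ∈ Ici a, HasDerivAt R (R' x) x) (hb : ∀ x ∈ Ici a, |R x| ≤ C)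
    (hR : ∀ x ∈ Ici a, x * R x - 1 ≤ R' x) : stdPDF a * R a ≤ stdCDF (-a) := by
  have h := le_of_hasDerivAt_nonneg_of_tendsto
    (fun x hx => ((hasDerivAt_stdPDF x).mul (hd x hx)).sub (hasDerivAt_stdCDF_neg x))
    (fun x hx => ?_) ((tendsto_stdPDF_mul hb).sub tendsto_stdCDF_neg)
  · simpa using h
  · have := mul_nonneg (stdPDF_pos x).le (sub_nonneg.2 (hR x hx))
    linarith

theorem stdCDF_neg_le_stdPDF_mul {R R' : ℝ → ℝ} {a C : ℝ}
    (hd : ∀ x ∈ Ici a, HasDerivAt R (R' x) x) (hb : ∀ x ∈ Ici a, |R x| ≤ C)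
    (hR : ∀ x ∈ Ici a, R' x ≤ x * R x - 1) : stdCDF (-a) ≤ stdPDF a * R a := by
  have h := le_of_hasDerivAt_nonneg_of_tendsto
    (fun x hx => (hasDerivAt_stdCDF_neg x).sub ((hasDerivAt_stdPDF x).mul (hd x hx)))
    (fun x hx => ?_) (tendsto_stdCDF_neg.sub (tendsto_stdPDF_mul hb))
  · simpa using h
  · have := mul_nonneg (stdPDF_pos x).le (sub_nonneg.2 (hR x hx))
    linarith

theorem integral_Ioi_sub_sq_mul_stdPDF (x : ℝ) :
    ∫ z in Ioi x, (z - x) ^ 2 * stdPDF z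
      = (1 + x ^ 2) * stdCDF (-x) - x * stdPDF x := by
  have hd : ∀ z ∈ Ici x, HasDerivAt
      (fun z => 2 * x * stdPDF z - z ^ 1 * stdPDF z - (1 + x ^ 2) * stdCDF (-z))
      ((z - x) ^ 2 * stdPDF z) z := by
    intro z _
    refine ((((hasDerivAt_stdPDF z).const_mul (2 * x)).sub
      ((hasDerivAt_pow 1 z).mul (hasDerivAt_stdPDF z))).sub
      ((hasDerivAt_stdCDF_neg z).const_mul (1 + x ^ 2))).congr_deriv ?_
    norm_num
    ring
  have ht := ((tendsto_stdPDF.const_mul (2 * x)).sub (tendsto_pow_mul_stdPDF 1)).sub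
    (tendsto_stdCDF_neg.const_mul (1 + x ^ 2))
  rw [integral_Ioi_of_hasDerivAt_of_nonneg' hd
    (fun z _ => mul_nonneg (sq_nonneg _) (stdPDF_pos z).le) ht]
  ring

theorem half_integral_sq_abs_sub {x : ℝ} (hx : 0 ≤ x) :
    (1 / 2) * (∫ z, (max (|z| - x) 0) ^ 2 ∂ gaussianReal 0 1)
      = (1 + x ^ 2) * stdCDF (-x) - x * stdPDF x := by
  rw [← integral_Ioi_sub_sq_mul_stdPDF, integral_gaussianReal_eq_integral_smul one_ne_zero]
  have h := integral_comp_abs (f := fun z => stdPDF z * (max (z - x) 0) ^ 2)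
  simp_rw [stdPDF_abs] at h
  simp_rw [gaussianPDFReal_zero_one, smul_eq_mul]
  have htail : ∫ z in Ioi 0, stdPDF z * (max (z - x) 0) ^ 2
      = ∫ z in Ioi x, stdPDF z * (max (z - x) 0) ^ 2 := by
    refine setIntegral_eq_of_subset_of_forall_sdiff_eq_zero measurableSet_Ioi
      (Ioi_subset_Ioi hx) fun z hz => ?_
    rw [max_eq_right (sub_nonpos.2 (not_lt.1 hz.2)), zero_pow two_ne_zero, mul_zero]
  rw [h, htail, ← mul_assoc, one_div, inv_mul_cancel₀ two_ne_zero, one_mul]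
  refine setIntegral_congr_fun measurableSet_Ioi fun z hz => ?_
  rw [mem_Ioi] at hz
  simp only [max_eq_left (sub_nonneg.2 hz.le), mul_comm]

theorem stdPDF_div_one_add_le {a : ℝ} (ha : 0 ≤ a) :
    stdPDF a / (1 + a) ≤ stdCDF (-a) := by
  rw [div_eq_mul_inv]
  refine stdPDF_mul_le_stdCDF_neg (R := fun x => (1 + x)⁻¹) (R' := fun x => -1 / (1 + x) ^ 2)
    (C := 1) (fun x hx => ?_) (fun x hx => ?_) (fun x hx => ?_)
  all_goals have hx0 : 0 ≤ x := ha.trans hx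
  · exact ((hasDerivAt_id x).const_add 1).inv (by simp only [id]; positivity)
  · rw [abs_of_nonneg (by positivity)]
    exact inv_le_one_of_one_le₀ (by linarith)
  · rw [← sub_nonneg]
    have : -1 / (1 + x) ^ 2 - (x * (1 + x)⁻¹ - 1) = x / (1 + x) ^ 2 := by
      field_simp
      ring
    rw [this]
    positivity

theorem stdCDF_neg_le_two_mul_div {a : ℝ} (ha : 0 ≤ a) :
    stdCDF (-a) ≤ 2 * stdPDF a / (1 + a) := by
  rw [mul_comm, mul_div_assoc, div_eq_mul_inv]
  refine stdCDF_neg_le_stdPDF_mul (R := fun x => 2 * (1 + x)⁻¹)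
    (R' := fun x => 2 * (-1 / (1 + x) ^ 2)) (C := 2)
    (fun x hx => ?_) (fun x hx => ?_) (fun x hx => ?_)
  all_goals have hx0 : 0 ≤ x := ha.trans hx
  · exact (((hasDerivAt_id x).const_add 1).inv (by simp only [id]; positivity)).const_mul 2
  · rw [abs_of_nonneg (by positivity)]
    linarith [inv_le_one_of_one_le₀ (show 1 ≤ 1 + x by linarith)]
  · rw [← sub_nonneg]
    have : x * (2 * (1 + x)⁻¹) - 1 - 2 * (-1 / (1 + x) ^ 2) = (1 + x ^ 2) / (1 + x) ^ 2 := by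
      field_simp
      ring
    rw [this]
    positivity

theorem one_add_two_mul_sq_le (x : ℝ) :
    (1 + 2 * x ^ 2) * Real.exp (-(x ^ 2) / 2) ≤ 2 := by
  have h1 : Real.exp (x ^ 2 / 2) = Real.exp (3 / 4) * Real.exp (x ^ 2 / 2 - 3 / 4) := by
    rw [← Real.exp_add]
    ring_nf
  have h2 := Real.add_one_le_exp (x ^ 2 / 2 - 3 / 4)
  have h3 : 2 ≤ Real.exp (3 / 4) := by
    have := Real.quadratic_le_exp_of_nonneg (show (0 : ℝ) ≤ 3 / 4 by norm_num)
    linarith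
  have h4 : 1 + 2 * x ^ 2 ≤ 2 * Real.exp (x ^ 2 / 2) := by
    rw [h1]
    nlinarith [sq_nonneg x]
  rw [neg_div, Real.exp_neg, ← div_eq_mul_inv, div_le_iff₀ (Real.exp_pos _)]
  exact h4

theorem half_stdPDF_sqrt_two_mul_le {a : ℝ} (ha : 0 ≤ a) :
    (1 / 2) * stdPDF (Real.sqrt 2 * a) ≤ stdPDF a - a * stdCDF (-a) := by
  rw [stdPDF_sqrt_two_mul]
  have hexp : ∀ x : ℝ, Real.exp (-(x ^ 2) / 2) ≤ 1 := fun x =>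
    Real.exp_le_one_iff.2 (by nlinarith [sq_nonneg x])
  rcases ha.eq_or_lt with rfl | ha
  · have := stdPDF_pos 0
    norm_num
    linarith
  have h := stdCDF_neg_le_stdPDF_mul (a := a) (C := 1 / a)
    (R := fun x => (1 - Real.exp (-(x ^ 2) / 2) / 2) / x)
    (R' := fun x => ((x * Real.exp (-(x ^ 2) / 2) / 2) * x -
      (1 - Real.exp (-(x ^ 2) / 2) / 2)) / x ^ 2)
    (fun x hx => ?_) (fun x hx => ?_) (fun x hx => ?_)
  · rw [← mul_div_assoc, le_div_iff₀ ha] at h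
    linarith
  all_goals have hx0 : 0 < x := ha.trans_le hx
  · refine ((((hasDerivAt_neg_sq_div_two x).exp.div_const 2).const_sub 1).div (hasDerivAt_id x) hx0.ne').congr_deriv ?_
    simp only [id]
    ring
  · have h0 := Real.exp_pos (-(x ^ 2) / 2)
    have h1 := hexp x
    rw [abs_of_nonneg (div_nonneg (by linarith) hx0.le)]
    exact div_le_div₀ zero_le_one (by linarith) ha hx
  · rw [div_le_iff₀ (by positivity), mul_div_cancel₀ _ hx0.ne']
    nlinarith [one_add_two_mul_sq_le x]

/-- The cubic for which `2 / P(x)` is a sharp lower bound of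
`((1 + x²) Φ(-x) - x φ(x)) / φ(x)`. -/
noncomputable def millsCubic (x : ℝ) : ℝ := x ^ 3 + x ^ 2 + 11 / 4 * x + 17 / 10

theorem millsCubic_ge {x : ℝ} (hx : 0 ≤ x) : 17 / 10 ≤ millsCubic x := by
  unfold millsCubic
  nlinarith [pow_nonneg hx 3, sq_nonneg x]

theorem hasDerivAt_millsCubic (x : ℝ) :
    HasDerivAt millsCubic (3 * x ^ 2 + 2 * x + 11 / 4) x := by
  refine ((((hasDerivAt_pow 3 x).add (hasDerivAt_pow 2 x)).add
    ((hasDerivAt_id x).const_mul (11 / 4))).add_const (17 / 10)).congr_deriv ?_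
  norm_num

theorem millsCubic_differential_ineq {x : ℝ} (hx : 0 ≤ x) :
    (3 * x ^ 2 + 2 * x + 11 / 4) * (1 + x ^ 2) + x * (3 + x ^ 2) * millsCubic x
      ≤ millsCubic x ^ 2 := by
  unfold millsCubic
  nlinarith [mul_nonneg hx (sq_nonneg (x * (x - 13 / 10))), mul_nonneg hx (sq_nonneg (x - 13 / 10)),
    sq_nonneg (x - 13 / 10), mul_nonneg hx (sq_nonneg (x ^ 2 - 169 / 100)),
    sq_nonneg (x * (x - 13 / 10))]

theorem millsCubic_le_one_add_pow {x : ℝ} (hx : 0 ≤ x) :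
    millsCubic x ≤ 4 * (1 + x ^ 3) := by
  unfold millsCubic
  nlinarith [mul_nonneg hx (sq_nonneg (x - 1)), sq_nonneg (x - 3 / 4), sq_nonneg (x - 1)]

theorem millsCubic_le_exp (x : ℝ) :
    millsCubic x ≤ 4 * Real.exp (x ^ 2 / 2) := by
  have h := Real.sum_le_exp_of_nonneg (show 0 ≤ x ^ 2 / 2 by positivity) 5
  simp only [Finset.sum_range_succ, Finset.sum_range_zero, Nat.factorial] at h
  norm_num at h
  refine le_trans ?_ (mul_le_mul_of_nonneg_left h (by norm_num))
  unfold millsCubic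
  nlinarith [sq_nonneg (x - 117 / 100), sq_nonneg (x * (x - 117 / 100)), sq_nonneg (x ^ 3 - 16 / 10),
    sq_nonneg (x ^ 4 - 187 / 100), sq_nonneg (x ^ 2 - 137 / 100)]

theorem two_div_millsCubic_mul_stdPDF_le {a : ℝ} (ha : 0 ≤ a) :
    stdPDF a * (2 / millsCubic a) ≤ (1 + a ^ 2) * stdCDF (-a) - a * stdPDF a := by
  have h := stdPDF_mul_le_stdCDF_neg (a := a) (C := 3)
    (R := fun x => (2 / millsCubic x + x) / (1 + x ^ 2))
    (R' := fun x => ((-2 * (3 * x ^ 2 + 2 * x + 11 / 4) / millsCubic x ^ 2 + 1) * (1 + x ^ 2)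
      - (2 / millsCubic x + x) * (2 * x)) / (1 + x ^ 2) ^ 2)
    (fun x hx => ?_) (fun x hx => ?_) (fun x hx => ?_)
  · rw [← mul_div_assoc, div_le_iff₀ (by positivity)] at h
    linarith
  all_goals
    have hx0 : 0 ≤ x := ha.trans hx
    have hP := millsCubic_ge hx0
    have hP0 : 0 < millsCubic x := by linarith
  · refine ((((hasDerivAt_const x (2 : ℝ)).div (hasDerivAt_millsCubic x) hP0.ne').add
      (hasDerivAt_id x)).div ((hasDerivAt_pow 2 x).const_add 1) (by positivity)).congr_deriv ?_
    norm_num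
  · rw [abs_of_nonneg (by positivity), div_le_iff₀ (by positivity)]
    have : 2 / millsCubic x ≤ 2 := by
      rw [div_le_iff₀ hP0]
      linarith
    nlinarith [sq_nonneg (x - 1)]
  · rw [← sub_nonneg]
    have : ((-2 * (3 * x ^ 2 + 2 * x + 11 / 4) / millsCubic x ^ 2 + 1) * (1 + x ^ 2)
        - (2 / millsCubic x + x) * (2 * x)) / (1 + x ^ 2) ^ 2
        - (x * ((2 / millsCubic x + x) / (1 + x ^ 2)) - 1)
        = 2 * (millsCubic x ^ 2 - ((3 * x ^ 2 + 2 * x + 11 / 4) * (1 + x ^ 2)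
          + x * (3 + x ^ 2) * millsCubic x)) / (millsCubic x ^ 2 * (1 + x ^ 2) ^ 2) := by
      field_simp
      ring
    rw [this]
    have := sub_nonneg.2 (millsCubic_differential_ineq hx0)
    positivity

theorem stdPDF_sqrt_two_mul_le_div {x : ℝ} (hx : 0 < x) :
    stdPDF (Real.sqrt 2 * x) ≤ stdPDF x / x := by
  rw [stdPDF_sqrt_two_mul, neg_div, Real.exp_neg, div_eq_mul_inv (stdPDF x)]
  have h : x ≤ Real.exp (x ^ 2 / 2) := by
    nlinarith [Real.add_one_le_exp (x ^ 2 / 2), sq_nonneg (x - 1)]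
  exact mul_le_mul_of_nonneg_left (inv_anti₀ hx h) (stdPDF_pos x).le

theorem max_le_sq_moment {x : ℝ} (hx : 0 ≤ x) :
    max (stdPDF x / (2 * (1 + x ^ 3))) (stdPDF (Real.sqrt 2 * x) / 2)
      ≤ (1 + x ^ 2) * stdCDF (-x) - x * stdPDF x := by
  refine le_trans ?_ (two_div_millsCubic_mul_stdPDF_le hx)
  have hP : 0 < millsCubic x := by linarith [millsCubic_ge hx]
  have hφ := (stdPDF_pos x).le
  refine max_le ?_ ?_
  · rw [div_eq_mul_inv]
    refine mul_le_mul_of_nonneg_left ?_ hφ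
    rw [← one_div, div_le_div_iff₀ (by positivity) hP]
    linarith [millsCubic_le_one_add_pow hx]
  · rw [stdPDF_sqrt_two_mul, mul_div_assoc]
    refine mul_le_mul_of_nonneg_left ?_ hφ
    rw [neg_div, Real.exp_neg, ← one_div, div_div,
      div_le_div_iff₀ (by positivity) hP]
    linarith [millsCubic_le_exp x]

/-- standard Gaussian inequalities:
(i) `½·E(|Z|−x)₊² = (1+x²)Φ(−x) − xφ(x) ≥ max(φ(x)/(2(1+x³)), φ(√2·x)/2)` for `x ≥ 0`;
(ii) `φ(x)/(1+x) ≤ Φ(−x) ≤ 2φ(x)/(1+x)` for `x ≥ 0`;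
(iii) `φ(x) − xΦ(−x) ≥ ½φ(√2·x)` for `x ≥ 0`, and `φ(x)/x ≥ φ(√2·x)` for `x > 0`. -/
theorem gaussian_numeric_bounds :
    (∀ x : ℝ, 0 ≤ x →
      ((1/2) * (∫ z, (max (|z| - x) 0) ^ 2 ∂ gaussianReal 0 1)
          = (1 + x ^ 2) * stdCDF (-x) - x * stdPDF x
        ∧ max (stdPDF x / (2 * (1 + x ^ 3))) (stdPDF (Real.sqrt 2 * x) / 2)
            ≤ (1 + x ^ 2) * stdCDF (-x) - x * stdPDF x)
      ∧ (stdPDF x / (1 + x) ≤ stdCDF (-x) ∧ stdCDF (-x) ≤ 2 * stdPDF x / (1 + x))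
      ∧ (1/2) * stdPDF (Real.sqrt 2 * x) ≤ stdPDF x - x * stdCDF (-x))
    ∧ ∀ x : ℝ, 0 < x → stdPDF (Real.sqrt 2 * x) ≤ stdPDF x / x := by
  exact ⟨fun x hx => ⟨⟨half_integral_sq_abs_sub hx, max_le_sq_moment hx⟩,
    ⟨stdPDF_div_one_add_le hx, stdCDF_neg_le_two_mul_div hx⟩, half_stdPDF_sqrt_two_mul_le hx⟩,
    fun x hx => stdPDF_sqrt_two_mul_le_div hx⟩
end
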